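/- Let β > 1 and let (λ(·), ω(·)) be a differentiable solution on [0,∞) of the closed-loop swing dynamics whose control inputs u_i satisfy, for every i ∈ 𝔠 and all t, (ω_i(t) − ω^∞)·u_i(λ(t),ω(t),p) ≤ 0. If λ(0) ∈ range(D) and (λ(0),ω(0)) ∈ Φ, then for every t ≥ 0: λ(t) ∈ range(D) and (λ(t),ω(t)) ∈ Φ. -/

import Mathlib

open Real BigOperators

theorem cos_tangent_gap_pos {a x : ℝ} (ha : |a| < π / 2) (hx : |x| ≤ π / 2) (hne : x ≠ a) :
    0 < cos a - cos x - x * sin a + a * sin a := by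
  rw [abs_lt] at ha
  rw [abs_le] at hx
  rcases lt_or_gt_of_ne hne with h | h
  · obtain ⟨ξ, hξ, h'⟩ := exists_hasDerivAt_eq_slope cos (fun y => -sin y) h
      continuous_cos.continuousOn (fun y _ => hasDerivAt_cos y)
    have hs : sin ξ < sin a := sin_lt_sin_of_lt_of_le_pi_div_two
      (by linarith [hξ.1]) ha.2.le hξ.2
    rw [eq_div_iff (by linarith)] at h'
    nlinarith
  · obtain ⟨ξ, hξ, h'⟩ := exists_hasDerivAt_eq_slope cos (fun y => -sin y) h
      continuous_cos.continuousOn (fun y _ => hasDerivAt_cos y)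
    have hs : sin a < sin ξ := sin_lt_sin_of_lt_of_le_pi_div_two
      ha.1.le (by linarith [hξ.2]) hξ.1
    rw [eq_div_iff (by linarith)] at h'
    nlinarith

theorem cos_tangent_gap_nonneg {a x : ℝ} (ha : |a| < π / 2) (hx : |x| ≤ π / 2) :
    0 ≤ cos a - cos x - x * sin a + a * sin a := by
  rcases eq_or_ne x a with rfl | hne
  · linarith
  · exact (cos_tangent_gap_pos ha hx hne).le

/-- A curve starting in a subspace whose velocity stays in the subspace never leaves it. -/
theorem mem_submodule_of_hasDerivAt {F : Type*} [NormedAddCommGroup F] [NormedSpace ℝ F]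
    [FiniteDimensional ℝ F] (S : Submodule ℝ F) {x v : ℝ → F}
    (hx : ∀ t ≥ (0 : ℝ), HasDerivAt x (v t) t) (hv : ∀ t ≥ (0 : ℝ), v t ∈ S) (h0 : x 0 ∈ S)
    {t : ℝ} (ht : 0 ≤ t) : x t ∈ S := by
  by_contra hmem
  obtain ⟨f, hf, hS⟩ := Submodule.exists_le_ker_of_notMem hmem
  have hd : ∀ s ≥ (0 : ℝ), HasDerivAt (fun r => f (x r)) 0 s := fun s hs => by
    have h := (LinearMap.toContinuousLinearMap f).hasFDerivAt.comp_hasDerivAt s (hx s hs)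
    have hz : f (v s) = 0 := hS (hv s hs)
    simpa [Function.comp_def, hz] using h
  have hconst := constant_of_has_deriv_right_zero (f := fun r => f (x r)) (a := 0) (b := t)
    (fun s hs => (hd s hs.1).continuousAt.continuousWithinAt)
    (fun s hs => (hd s hs.1).hasDerivWithinAt) t ⟨ht, le_rfl⟩
  have hz : f (x 0) = 0 := hS h0
  exact hf (by simpa [hz] using hconst)

/-- The power balance: the rate of change of the energy is the damping loss plus the control
power, hence nonpositive. -/
theorem energy_rate_nonpos {n m : ℕ} (D : Matrix (Fin m) (Fin n) ℝ)
    (hD : ∀ k, ∑ i, D k i = 0) (Yb : Fin m → ℝ) (M E p ω a v : Fin n → ℝ) (ωinf : ℝ)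
    (lamInf lam : Fin m → ℝ) (hE : ∀ i, 0 < E i)
    (heq : ∀ i, p i - ωinf * E i = ∑ j, D j i * Yb j * sin (lamInf j))
    (hdyn : ∀ i, M i * a i =
      -E i * ω i - (∑ j, D j i * Yb j * sin (lam j)) + p i + v i)
    (hv : ∀ i, (ω i - ωinf) * v i ≤ 0) :
    ∑ i, M i * a i * (ω i - ωinf)
      + ∑ j, Yb j * ((sin (lam j) - sin (lamInf j)) * D.mulVec ω j) ≤ 0 := by
  have hflow : ∀ j, D.mulVec ω j = ∑ i, D j i * (ω i - ωinf) := fun j => by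
    simp [Matrix.mulVec, dotProduct, mul_sub, Finset.sum_sub_distrib, ← Finset.sum_mul, hD]
  have hswap : ∑ j, Yb j * ((sin (lam j) - sin (lamInf j)) * D.mulVec ω j)
      = ∑ i, ((∑ j, D j i * Yb j * sin (lam j))
          - ∑ j, D j i * Yb j * sin (lamInf j)) * (ω i - ωinf) := by
    simp_rw [hflow, ← Finset.sum_sub_distrib, Finset.mul_sum, Finset.sum_mul]
    rw [Finset.sum_comm]
    exact Finset.sum_congr rfl fun i _ => Finset.sum_congr rfl fun j _ => by ring
  rw [hswap, ← Finset.sum_add_distrib]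
  refine Finset.sum_nonpos fun i _ => ?_
  rw [hdyn i, ← heq i]
  nlinarith [hv i, mul_nonneg (hE i).le (sq_nonneg (ω i - ωinf))]

/-- Invariance of `range(D)` and of the sublevel set `Φ` along any differentiable
solution of the closed-loop swing dynamics whose control inputs satisfy
`(ω_i − ω∞)·u_i ≤ 0` for all controlled buses. -/
theorem Phi_invariant
    (n m : ℕ)
    (D : Matrix (Fin m) (Fin n) ℝ)
    (hD : ∀ k : Fin m, ∃ i j : Fin n, i ≠ j ∧ D k i = 1 ∧ D k j = -1 ∧
      ∀ l, l ≠ i → l ≠ j → D k l = 0)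
    (Yb : Fin m → ℝ) (hYb : ∀ j, 0 < Yb j)
    (M E : Fin n → ℝ) (hM : ∀ i, 0 < M i) (hE : ∀ i, 0 < E i)
    (p : Fin n → ℝ) (C : Set (Fin n))
    (u : Fin n → (Fin m → ℝ) → (Fin n → ℝ) → (Fin n → ℝ) → ℝ)
    (hu0 : ∀ i ∉ C, ∀ lam ω q, u i lam ω q = 0)
    (ωinf : ℝ) (hωinf : ωinf = (∑ i, p i) / (∑ i, E i))
    (lamInf : Fin m → ℝ) (hrange : ∃ θ, D.mulVec θ = lamInf)
    (hbound : ∀ j, |lamInf j| < π / 2)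
    (heq : ∀ i, p i - ωinf * E i = ∑ j, D j i * Yb j * Real.sin (lamInf j))
    -- the energy function, the closed region and the level constant
    (V : (Fin m → ℝ) → (Fin n → ℝ) → ℝ)
    (hV : V = fun lam ω =>
      (1 / 2) * ∑ i, M i * (ω i - ωinf) ^ 2
        + ∑ j, Yb j * (Real.cos (lamInf j) - Real.cos (lam j)
            - lam j * Real.sin (lamInf j) + lamInf j * Real.sin (lamInf j)))
    (Γcl : Set (Fin m → ℝ)) (hΓcl : Γcl = {lam | ∀ j, |lam j| ≤ π / 2})
    (c : ℝ) (hc : c = sInf ((fun lam => V lam (fun _ => ωinf)) '' frontier Γcl))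
    (β : ℝ) (hβ : 1 < β)
    (Φ : Set ((Fin m → ℝ) × (Fin n → ℝ)))
    (hΦ : Φ = {x | x.1 ∈ Γcl ∧ V x.1 x.2 ≤ c / β})
    -- the solution
    (lam : ℝ → Fin m → ℝ) (ω : ℝ → Fin n → ℝ) (ωd : ℝ → Fin n → ℝ)
    (hlam : ∀ t ≥ (0 : ℝ), HasDerivAt lam (D.mulVec (ω t)) t)
    (hω : ∀ t ≥ (0 : ℝ), ∀ i, HasDerivAt (fun s => ω s i) (ωd t i) t)
    (hdyn : ∀ t ≥ (0 : ℝ), ∀ i, M i * ωd t i =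
      -E i * ω t i - (∑ j, D j i * Yb j * Real.sin (lam t j)) + p i
        + u i (lam t) (ω t) p)
    (huc : ∀ i ∈ C, ∀ t ≥ (0 : ℝ), (ω t i - ωinf) * u i (lam t) (ω t) p ≤ 0)
    -- initial conditions
    (h0range : ∃ θ, D.mulVec θ = lam 0)
    (h0Φ : (lam 0, ω 0) ∈ Φ) :
    ∀ t ≥ (0 : ℝ), (∃ θ, D.mulVec θ = lam t) ∧ (lam t, ω t) ∈ Φ := by
  have hD0 : ∀ k, ∑ i, D k i = 0 := fun k => by
    obtain ⟨i, j, hij, hi, hj, hl⟩ := hD k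
    rw [Fintype.sum_eq_add i j hij (fun l hl' => hl l hl'.1 hl'.2), hi, hj]
    norm_num
  have hΓ : Γcl = Metric.closedBall 0 (π / 2) := by
    ext x
    simp [hΓcl, pi_norm_le_iff_of_nonneg pi_div_two_pos.le]
  have hlamj : ∀ t ≥ (0 : ℝ), ∀ j, HasDerivAt (fun s => lam s j) (D.mulVec (ω t) j) t :=
    fun t ht => hasDerivAt_pi.1 (hlam t ht)
  have hVd : ∀ t ≥ (0 : ℝ), HasDerivAt (fun s => V (lam s) (ω s))
      (∑ i, M i * ωd t i * (ω t i - ωinf)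
        + ∑ j, Yb j * ((sin (lam t j) - sin (lamInf j)) * D.mulVec (ω t) j)) t := by
    intro t ht
    subst hV
    refine HasDerivAt.add ?_ ?_
    · have h := (HasDerivAt.fun_sum (u := Finset.univ) fun i _ =>
        (((hω t ht i).sub_const ωinf).fun_pow 2).const_mul (M i)).const_mul (1 / 2)
      refine h.congr_deriv ?_
      rw [Finset.mul_sum]
      exact Finset.sum_congr rfl fun i _ => by push_cast; ring
    · refine HasDerivAt.fun_sum fun j _ => HasDerivAt.const_mul (Yb j) ?_
      have h := ((((hlamj t ht j).cos).const_sub (cos (lamInf j))).sub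
        ((hlamj t ht j).mul_const (sin (lamInf j)))).add_const (lamInf j * sin (lamInf j))
      refine h.congr_deriv ?_
      ring
  have hanti : AntitoneOn (fun s => V (lam s) (ω s)) (Set.Ici 0) := by
    refine antitoneOn_of_hasDerivWithinAt_nonpos (convex_Ici 0)
      (fun t ht => (hVd t ht).continuousAt.continuousWithinAt)
      (fun t ht => (hVd t (interior_subset ht)).hasDerivWithinAt) fun t ht => ?_
    have ht0 : (0 : ℝ) ≤ t := interior_subset ht
    refine energy_rate_nonpos D hD0 Yb M E p (ω t) (ωd t) _ ωinf lamInf (lam t) hE heq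
      (hdyn t ht0) fun i => ?_
    by_cases hi : i ∈ C
    · exact huc i hi t ht0
    · simp [hu0 i hi]
  have hfr : frontier Γcl = Metric.sphere 0 (π / 2) := by
    rw [hΓ, frontier_closedBall _ pi_div_two_pos.ne']
  have hVcont : Continuous fun x => V x fun _ => ωinf := by
    subst hV
    fun_prop
  rw [hΦ] at h0Φ
  have hlevel : ∀ t ≥ (0 : ℝ), V (lam t) (ω t) ≤ c / β := fun t ht =>
    (hanti Set.self_mem_Ici ht ht).trans h0Φ.2
  have havoid : ∀ s ≥ (0 : ℝ), lam s ∉ Metric.sphere 0 (π / 2) := by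
    intro s hs hsph
    have hcpt : IsCompact ((fun x => V x fun _ => ωinf) '' frontier Γcl) := by
      rw [hfr]
      exact (isCompact_sphere _ _).image hVcont
    have hmem := Set.mem_image_of_mem (fun x => V x fun _ => ωinf) (hfr.symm ▸ hsph)
    have hcle : c ≤ V (lam s) fun _ => ωinf := hc ▸ csInf_le hcpt.bddBelow hmem
    have hVle : V (lam s) (fun _ => ωinf) ≤ V (lam s) (ω s) := by
      have hkin : 0 ≤ ∑ i, M i * (ω s i - ωinf) ^ 2 :=
        Finset.sum_nonneg fun i _ => mul_nonneg (hM i).le (sq_nonneg _)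
      simp only [hV, sub_self]
      norm_num
      exact hkin
    obtain ⟨x, hx, hxc⟩ : c ∈ (fun x => V x fun _ => ωinf) '' frontier Γcl :=
      hc ▸ hcpt.sInf_mem ⟨_, hmem⟩
    rw [hfr, mem_sphere_zero_iff_norm] at hx
    have hxj : ∀ j, |x j| ≤ π / 2 := fun j => (norm_le_pi_norm x j).trans hx.le
    have hne : x ≠ lamInf := by
      rintro rfl
      exact absurd hx ((pi_norm_lt_iff pi_div_two_pos).2 hbound).ne
    obtain ⟨j, hj⟩ := Function.ne_iff.1 hne
    have hcpos : 0 < c := by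
      rw [← hxc, hV]
      simp only [sub_self]
      norm_num
      exact Finset.sum_pos'
        (fun k _ => mul_nonneg (hYb k).le (cos_tangent_gap_nonneg (hbound k) (hxj k)))
        ⟨j, Finset.mem_univ j, mul_pos (hYb j) (cos_tangent_gap_pos (hbound j) (hxj j) hj)⟩
    have hlt : c / β < c := div_lt_self hcpos hβ
    linarith [hlevel s hs]
  intro t ht
  refine ⟨mem_submodule_of_hasDerivAt (LinearMap.range D.mulVecLin) hlam
    (fun s _ => ⟨ω s, rfl⟩) h0range ht, ?_⟩
  rw [hΦ]
  refine ⟨?_, hlevel t ht⟩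
  by_contra hout
  have h0 : ‖lam 0‖ ≤ π / 2 := by simpa [hΓ] using h0Φ.1
  have h1 : π / 2 ≤ ‖lam t‖ := by
    have h : ¬ ‖lam t‖ ≤ π / 2 := by simpa [hΓ] using hout
    exact (not_le.1 h).le
  obtain ⟨s, hs, hs'⟩ := intermediate_value_Icc ht
    (f := fun r => ‖lam r‖)
    (fun r hr => (hlam r hr.1).continuousAt.norm.continuousWithinAt) ⟨h0, h1⟩
  exact havoid s hs.1 (mem_sphere_zero_iff_norm.2 hs')
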